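/- For every quantum protocol as described (any number of parties N ≥ 1, any number of time-steps T ≥ N, any finite-dimensional system space, any measurement unitaries V_{s,r_l}(x_l) for each party and setting, and any unitaries U_1,…,U_T, such that the flag constraint holds for every choice of settings x⃗), the resulting family of outcome distributions p^quantum(a⃗|x⃗) is a causal distribution: there exist conditional probabilities p_k(l_k|H_{k−1}) and p_k(a_{l_k}|H_{k−1}, x_{l_k}) as in the definition of a causal model such that for all settings x⃗ and all outcomes a⃗, p^quantum(a⃗|x⃗) equals the causal-model expression. Hence quantum theory cannot violate a causal inequality. -/

import Mathlib

noncomputable section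

/-!
Shared framework: quantum protocols with a quantum control of causal order,
following Purves & Short, "Quantum theory cannot violate a causal inequality".

The total Hilbert space `H_s ⊗ H_c ⊗ (⊗ᵢ H_{rᵢ}) ⊗ (⊗ᵢ H_{fᵢ})` is modelled
concretely as `ℓ²` of the finite basis-index set
`Idx = S × Fin (N+1) × (Π i, A i) × (Π i, Fin (T+1))`
(system basis, control basis |0⟩,…,|N⟩, result-register bases, flag bases),
vectors being functions `Idx → ℂ`, operators being matrices.
-/

namespace CIQ

variable {N T : ℕ} {S : Type} [Fintype S] [DecidableEq S]
variable {A : Fin N → Type} [∀ i, Fintype (A i)] [∀ i, DecidableEq (A i)]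
variable {X : Fin N → Type} [∀ i, Fintype (X i)] [∀ i, DecidableEq (X i)]

/-- Basis index set of the total Hilbert space: system × control × results × flags. -/
abbrev Idx (N T : ℕ) (S : Type) (A : Fin N → Type) : Type :=
  S × Fin (N + 1) × ((i : Fin N) → A i) × ((i : Fin N) → Fin (T + 1))

/-- A history: an ordered list of triples (lab, outcome, setting). -/
abbrev Hist (N : ℕ) (A X : Fin N → Type) : Type := List ((l : Fin N) × (A l × X l))

/-- The labs occurring in a history are pairwise distinct. -/
def labsDistinct (H : Hist N A X) : Prop := (H.map Sigma.fst).Nodup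

/-- Squared ℓ²-norm ‖v‖². -/
def nsq (v : Idx N T S A → ℂ) : ℝ := ∑ p, Complex.normSq (v p)

/-- The ℓ² inner product ⟨v|w⟩ (conjugate-linear in the first argument). -/
def hinner (v w : Idx N T S A → ℂ) : ℂ := ∑ p, (starRingEnd ℂ) (v p) * w p

/-- The data of a quantum protocol: a distinguished initial system basis state `s0`,
initial result-register states `r0`, measurement unitaries `Vm l x` on `H_s ⊗ H_{r_l}`
for each lab and setting, and inter-step unitaries `U t` on `H_s ⊗ H_c` (for `1 ≤ t ≤ T`). -/
structure Protocol (N T : ℕ) (S : Type) (A X : Fin N → Type) where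
  s0 : S
  r0 : ∀ i, A i
  Vm : (l : Fin N) → X l → Matrix (S × A l) (S × A l) ℂ
  U : ℕ → Matrix (S × Fin (N + 1)) (S × Fin (N + 1)) ℂ

/-- Extension of an operator on `H_s ⊗ H_c` by the identity on results and flags. -/
def extSC (M : Matrix (S × Fin (N + 1)) (S × Fin (N + 1)) ℂ) :
    Matrix (Idx N T S A) (Idx N T S A) ℂ := fun p q =>
  if p.2.2 = q.2.2 then M (p.1, p.2.1) (q.1, q.2.1) else 0

namespace Protocol

variable (P : Protocol N T S A X) (x : ∀ l, X l)

/-- Each measurement unitary is indeed unitary. -/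
def unitaryVm : Prop := ∀ (l : Fin N) (xv : X l), P.Vm l xv ∈ Matrix.unitaryGroup (S × A l) ℂ

/-- Each inter-step unitary `U t`, `1 ≤ t ≤ T`, is indeed unitary. -/
def unitaryU : Prop :=
  ∀ t : ℕ, 1 ≤ t → t ≤ T → P.U t ∈ Matrix.unitaryGroup (S × Fin (N + 1)) ℂ

/-- The initial state |0⟩ = |0⟩_s |0⟩_c |0⟩_r^N |0⟩_f^N. -/
def ket0 : Idx N T S A → ℂ :=
  fun p => if p = (P.s0, 0, P.r0, fun _ => 0) then 1 else 0

/-- The lab-activation unitary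
`V = |0⟩⟨0|_c ⊗ I + Σ_{l=1}^N |l⟩⟨l|_c ⊗ V_{s,r_l}(x_l) ⊗ Γ_{f_l} ⊗ I`,
where `Γ` is the cyclic shift raising the flag. -/
def Vmat : Matrix (Idx N T S A) (Idx N T S A) ℂ := fun p q =>
  if h : p.2.1 = (0 : Fin (N + 1)) then (if q = p then 1 else 0)
  else
    if q.2.1 = p.2.1 ∧ (∀ i, i ≠ p.2.1.pred h → q.2.2.1 i = p.2.2.1 i)
        ∧ (∀ i, i ≠ p.2.1.pred h → q.2.2.2 i = p.2.2.2 i)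
        ∧ q.2.2.2 (p.2.1.pred h) + 1 = p.2.2.2 (p.2.1.pred h) then
      P.Vm (p.2.1.pred h) (x (p.2.1.pred h))
        (p.1, p.2.2.1 (p.2.1.pred h)) (q.1, q.2.2.1 (p.2.1.pred h))
    else 0

/-- `chain t = V U_t V U_{t-1} ⋯ V U_1`. -/
def chain : ℕ → Matrix (Idx N T S A) (Idx N T S A) ℂ
  | 0 => 1
  | t + 1 => P.Vmat x * (extSC (P.U (t + 1)) * chain t)

/-- `pre t = U_t V U_{t-1} ⋯ V U_1` (the evolution just before the `t`-th activation). -/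
def pre (t : ℕ) : Matrix (Idx N T S A) (Idx N T S A) ℂ :=
  extSC (P.U t) * P.chain x (t - 1)

/-- The total unitary `𝒰 = V U_T V U_{T-1} ⋯ V U_1`. -/
def Uop : Matrix (Idx N T S A) (Idx N T S A) ℂ := P.chain x T

/-- `tailPhi k = V U_T V U_{T-1} ⋯ U_{T-k+1}` (evolution to the end of the protocol,
starting just after the `(T-k)`-th activation); `k` counts remaining time steps. -/
def tailPhi : ℕ → Matrix (Idx N T S A) (Idx N T S A) ℂ
  | 0 => 1
  | k + 1 => tailPhi k * (P.Vmat x * extSC (P.U (T - k)))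

end Protocol

/-- The condition imposed by the projector `π^H_{rf}`: result registers of labs in the
history `H` show the recorded outcomes and their flags are raised (to `1`), while the
flags of all other labs read `0`. -/
def histSat (H : Hist N A X) (rr : ∀ i, A i) (ff : (i : Fin N) → Fin (T + 1)) : Prop :=
  (∀ e ∈ H, rr e.1 = e.2.1 ∧ ff e.1 = 1) ∧ (∀ i : Fin N, (∀ e ∈ H, e.1 ≠ i) → ff i = 0)

instance (H : Hist N A X) (rr : ∀ i, A i) (ff : (i : Fin N) → Fin (T + 1)) :
    Decidable (histSat H rr ff) := by
  unfold histSat; infer_instance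

namespace Protocol

variable (P : Protocol N T S A X) (x : ∀ l, X l)

/-- `|ψ_{(l,t,H)}⟩ = (|l⟩⟨l|_c ⊗ π^H_{rf} ⊗ I_s) U_t V U_{t-1} ⋯ V U_1 |0⟩`,
where the control value `l ∈ {0,1,…,N}`. -/
def psi (l : Fin (N + 1)) (t : ℕ) (H : Hist N A X) : Idx N T S A → ℂ := fun p =>
  if p.2.1 = l ∧ histSat H p.2.2.1 p.2.2.2 then (P.pre x t).mulVec (P.ket0) p else 0

/-- `|ψ̄_{(l,t,H)}⟩ = V U_T V U_{T-1} ⋯ U_{t+1} V |ψ_{(l,t,H)}⟩`. -/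
def psibar (l : Fin (N + 1)) (t : ℕ) (H : Hist N A X) : Idx N T S A → ℂ :=
  (P.tailPhi x (T - t) * P.Vmat x).mulVec (P.psi x l t H)

/-- The just-measured state with previous history `H`:
`(|a⟩⟨a|_{r_l} ⊗ I) V |ψ_{(l,t,H)}⟩` (control value `l` among `1,…,N`). -/
def phiOf (l : Fin N) (a : A l) (t : ℕ) (H : Hist N A X) : Idx N T S A → ℂ := fun p =>
  if p.2.2.1 l = a then (P.Vmat x).mulVec (P.psi x l.succ t H) p else 0

/-- `|φ_{(l,t,H)}⟩` for a lab `l` whose triple `(l, a, x_l)` occurs in the history `H`: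
`(|a⟩⟨a|_{r_l} ⊗ I) V |ψ_{(l,t,H∖(l,a,x_l))}⟩`. -/
def phiFull (l : Fin N) (a : A l) (t : ℕ) (H : Hist N A X) : Idx N T S A → ℂ :=
  P.phiOf x l a t (H.filter fun e => decide (e.1 ≠ l))

/-- `|φ̄_{(l,t,H)}⟩ = V U_T V ⋯ U_{t+1} |φ_{(l,t,H)}⟩`. -/
def phibar (l : Fin N) (a : A l) (t : ℕ) (H : Hist N A X) : Idx N T S A → ℂ :=
  (P.tailPhi x (T - t)).mulVec (P.phiFull x l a t H)

/-- `|φ_{(0,t,H)}⟩ = V |ψ_{(0,t,H)}⟩`. -/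
def phi0 (t : ℕ) (H : Hist N A X) : Idx N T S A → ℂ :=
  (P.Vmat x).mulVec (P.psi x 0 t H)

/-- `|φ̄_{(0,t,H)}⟩ = V U_T V ⋯ U_{t+1} |φ_{(0,t,H)}⟩`. -/
def phibar0 (t : ℕ) (H : Hist N A X) : Idx N T S A → ℂ :=
  (P.tailPhi x (T - t)).mulVec (P.phi0 x t H)

/-- `Σ_{t=1}^T ‖ψ_{(l,t,H)}‖²` (numerator of Definition 4). -/
def numPsi (H : Hist N A X) (l : Fin N) : ℝ :=
  ∑ t ∈ Finset.Icc 1 T, nsq (P.psi x l.succ t H)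

/-- `Σ_{l'∉ℒ} Σ_{t=1}^T ‖ψ_{(l',t,H)}‖²` (denominator of Definition 4). -/
def denPsi (H : Hist N A X) : ℝ :=
  ∑ l ∈ Finset.univ.filter (fun l : Fin N => ∀ e ∈ H, e.1 ≠ l), P.numPsi x H l

/-- Definition 4: `p_k(l_k|H_{k-1})`, the probability for lab `l` to act next. -/
def pNext (H : Hist N A X) (l : Fin N) : ℝ := P.numPsi x H l / P.denPsi x H

/-- `Σ_{t=1}^T ‖φ_{(l,t,(H,(l,a,x_l)))}‖²` (numerator of Definition 5). -/
def numPhi (H : Hist N A X) (l : Fin N) (a : A l) : ℝ :=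
  ∑ t ∈ Finset.Icc 1 T, nsq (P.phiOf x l a t H)

/-- Definition 5: `p_k(a|H_{k-1},x_l)`, the probability for lab `l`, acting next after
history `H` with its setting `x l`, to obtain outcome `a`. -/
def pOut (H : Hist N A X) (l : Fin N) (a : A l) : ℝ :=
  P.numPhi x H l a / ∑ a' : A l, P.numPhi x H l a'

/-- The quantum outcome distribution
`p^quantum(a⃗|x⃗) = ‖(|a⃗⟩⟨a⃗|_r ⊗ I) 𝒰 |0⟩‖²`. -/
def pQ (a : ∀ i, A i) : ℝ :=
  nsq (fun p => if p.2.2.1 = a then (P.Uop x).mulVec P.ket0 p else 0)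

/-- The flag constraint: at the end of the protocol every flag reads `1`
(each party has interacted with the system exactly once). -/
def flagOK : Prop :=
  ∀ p : Idx N T S A, (P.Uop x).mulVec P.ket0 p ≠ 0 → ∀ i, p.2.2.2 i = 1

end Protocol

/-- The causal-model expression of Definition 1, written recursively:
`causalSum q o x a k H` sums over the next `k` parties to act (those not in `H`),
multiplying the 'who is next?' probabilities `q` and the 'what did they see?'
probabilities `o`, with the history extended accordingly.  The full expression
of Definition 1 is `causalSum q o x a N []`. -/
def causalSum (q : Hist N A X → Fin N → ℝ)
    (o : Hist N A X → (l : Fin N) → X l → A l → ℝ)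
    (x : ∀ i, X i) (a : ∀ i, A i) : ℕ → Hist N A X → ℝ
  | 0, _ => 1
  | k + 1, H =>
      ∑ l : Fin N,
        if ∀ e ∈ H, e.1 ≠ l then
          q H l * o H l (x l) (a l) * causalSum q o x a k (H ++ [⟨l, (a l, x l)⟩])
        else 0

end CIQ

end


open CIQ CIQ.Protocol

set_option linter.unusedSectionVars false

noncomputable section

namespace CIQ

variable {N T : ℕ} {S : Type} [Fintype S] [DecidableEq S]
variable {A : Fin N → Type} [∀ i, Fintype (A i)] [∀ i, DecidableEq (A i)]
variable {X : Fin N → Type}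

/-! ### Isometries and masses of basis subsets -/

theorem sum_normSq_mulVec_of_unitary {ι : Type*} [Fintype ι] [DecidableEq ι] {M : Matrix ι ι ℂ}
    (hM : M ∈ Matrix.unitaryGroup ι ℂ) (v : ι → ℂ) :
    ∑ i, Complex.normSq (M.mulVec v i) = ∑ i, Complex.normSq (v i) := by
  have key : ∀ w : ι → ℂ, ((∑ i, Complex.normSq (w i) : ℝ) : ℂ) = star w ⬝ᵥ w := by
    intro w
    simp [dotProduct, Complex.normSq_eq_conj_mul_self]
  rw [Matrix.mem_unitaryGroup_iff', Matrix.star_eq_conjTranspose] at hM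
  apply Complex.ofReal_injective
  rw [key, key, Matrix.star_mulVec, Matrix.dotProduct_mulVec, Matrix.vecMul_vecMul, hM,
    Matrix.vecMul_one]

/-- Squared norm of the component of `v` supported on the set `g` of basis indices. -/
def mass (v : Idx N T S A → ℂ) (g : Set (Idx N T S A)) : ℝ := nsq (g.indicator v)

theorem nsq_nonneg (v : Idx N T S A → ℂ) : 0 ≤ nsq v :=
  Finset.sum_nonneg fun _ _ => Complex.normSq_nonneg _

theorem mass_nonneg (v : Idx N T S A → ℂ) (g : Set (Idx N T S A)) : 0 ≤ mass v g :=
  nsq_nonneg _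

theorem mass_eq_zero_iff {v : Idx N T S A → ℂ} {g : Set (Idx N T S A)} :
    mass v g = 0 ↔ ∀ p ∈ g, v p = 0 := by
  classical
  unfold mass nsq
  rw [Finset.sum_eq_zero_iff_of_nonneg fun _ _ => Complex.normSq_nonneg _]
  simp [Set.indicator_apply]

theorem mass_mono {v : Idx N T S A → ℂ} {g h : Set (Idx N T S A)}
    (H : ∀ p ∈ g, v p ≠ 0 → p ∈ h) : mass v g ≤ mass v h := by
  classical
  refine Finset.sum_le_sum fun p _ => ?_
  simp only [Set.indicator_apply]
  by_cases hp : p ∈ g <;> by_cases hv : v p = 0 <;> simp [hp, hv, Complex.normSq_nonneg]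
  simp [H p hp hv]

theorem mass_congr {v w : Idx N T S A → ℂ} {g : Set (Idx N T S A)}
    (H : ∀ p ∈ g, v p = w p) : mass v g = mass w g :=
  congrArg nsq (Set.indicator_congr H)

theorem mass_eq_sum_inter {ι : Type*} [Fintype ι] [DecidableEq ι] (v : Idx N T S A → ℂ)
    (g : Set (Idx N T S A)) (f : Idx N T S A → ι) :
    mass v g = ∑ c, mass v (g ∩ {p | f p = c}) := by
  classical
  unfold mass nsq
  rw [Finset.sum_comm]
  refine Finset.sum_congr rfl fun p _ => ?_
  rw [Finset.sum_eq_single (f p)]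
  · by_cases hp : p ∈ g <;> simp [hp]
  · intro c _ hc
    simp [hc.symm]
  · simp

theorem mass_mulVec {M : Matrix (Idx N T S A) (Idx N T S A) ℂ}
    (hM : ∀ w, nsq (M.mulVec w) = nsq w) {g g' : Set (Idx N T S A)}
    (h : ∀ p q, M p q ≠ 0 → (p ∈ g ↔ q ∈ g')) (v : Idx N T S A → ℂ) :
    mass (M.mulVec v) g = mass v g' := by
  classical
  unfold mass
  rw [← hM (g'.indicator v)]
  congr 1
  funext p
  by_cases hp : p ∈ g
  · rw [Set.indicator_of_mem hp]
    refine Finset.sum_congr rfl fun q _ => ?_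
    by_cases hq : M p q = 0
    · simp [hq]
    · rw [Set.indicator_of_mem ((h p q hq).1 hp)]
  · rw [Set.indicator_of_notMem hp]
    refine (Finset.sum_eq_zero fun q _ => ?_).symm
    by_cases hq : M p q = 0
    · simp [hq]
    · rw [Set.indicator_of_notMem (fun hq' => hp ((h p q hq).2 hq')), mul_zero]

/-! ### The evolution operators are isometries -/

theorem nsq_extSC_mulVec {M : Matrix (S × Fin (N + 1)) (S × Fin (N + 1)) ℂ}
    (hM : M ∈ Matrix.unitaryGroup (S × Fin (N + 1)) ℂ) (w : Idx N T S A → ℂ) :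
    nsq ((extSC M).mulVec w) = nsq w := by
  have app : ∀ p : Idx N T S A, (extSC M).mulVec w p =
      M.mulVec (fun z => w (z.1, z.2, p.2.2)) (p.1, p.2.1) := by
    rintro ⟨s, c, y⟩
    symm
    refine Fintype.sum_of_injective
      (fun z : S × Fin (N + 1) => ((z.1, z.2, y) : Idx N T S A)) ?_ _ _ ?_ ?_
    · rintro ⟨a, b⟩ ⟨a', b'⟩ h
      simp at h
      simp [h]
    · rintro ⟨s', c', y'⟩ hq
      have : y ≠ y' := by
        rintro rfl
        exact hq ⟨(s', c'), rfl⟩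
      simp [extSC, this]
    · intro z
      simp [extSC]
  have split : ∀ u : Idx N T S A → ℝ, ∑ p, u p =
      ∑ y : ((i : Fin N) → A i) × ((i : Fin N) → Fin (T + 1)),
        ∑ z : S × Fin (N + 1), u (z.1, z.2, y) := by
    intro u
    rw [← Fintype.sum_prod_type_right', ← Equiv.sum_comp (Equiv.prodAssoc _ _ _)]
    rfl
  unfold nsq
  rw [split, split]
  refine Finset.sum_congr rfl fun y _ => ?_
  simp only [app]
  exact sum_normSq_mulVec_of_unitary hM (fun z => w (z.1, z.2, y))

theorem extSC_ne_zero {M : Matrix (S × Fin (N + 1)) (S × Fin (N + 1)) ℂ}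
    {p q : Idx N T S A} (h : extSC M p q ≠ 0) : p.2.2 = q.2.2 := by
  by_contra hne
  exact h (if_neg hne)

namespace Protocol

variable (P : Protocol N T S A X) (x : ∀ l, X l)

theorem Vmat_ne_zero {p q : Idx N T S A} (h : P.Vmat x p q ≠ 0) :
    q.2.1 = p.2.1 ∧ (p.2.1 = 0 → q = p) ∧ ∀ l : Fin N, p.2.1 = l.succ →
      (∀ i, i ≠ l → q.2.2.1 i = p.2.2.1 i) ∧ (∀ i, i ≠ l → q.2.2.2 i = p.2.2.2 i) ∧
        q.2.2.2 l + 1 = p.2.2.2 l := by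
  unfold Vmat at h
  by_cases hp : p.2.1 = 0
  · rw [dif_pos hp] at h
    have hq : q = p := by
      by_contra hq
      exact h (if_neg hq)
    subst hq
    refine ⟨rfl, fun _ => rfl, fun l hl => ?_⟩
    exact absurd (hl.symm.trans hp) (Fin.succ_ne_zero l)
  · rw [dif_neg hp] at h
    have hq := (ite_ne_right_iff.1 h).1
    refine ⟨hq.1, fun h0 => absurd h0 hp, fun l hl => ?_⟩
    have : p.2.1.pred hp = l := by
      simp [hl]
    rw [this] at hq
    exact hq.2

theorem Vmat_apply_succ (s : S) (l : Fin N) (r : ∀ i, A i) (f : Fin N → Fin (T + 1))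
    (q : Idx N T S A) : P.Vmat x (s, l.succ, r, f) q =
      if q.2.1 = l.succ ∧ (∀ i, i ≠ l → q.2.2.1 i = r i) ∧ (∀ i, i ≠ l → q.2.2.2 i = f i) ∧
        q.2.2.2 l + 1 = f l then P.Vm l (x l) (s, r l) (q.1, q.2.2.1 l) else 0 :=
  dif_neg (Fin.succ_ne_zero l)

theorem Vmat_mulVec_zero (w : Idx N T S A → ℂ) (p : Idx N T S A) (hp : p.2.1 = 0) :
    (P.Vmat x).mulVec w p = w p := by
  unfold Matrix.mulVec dotProduct
  rw [Finset.sum_eq_single p]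
  · simp [Vmat, hp]
  · intro q _ hq
    simp [Vmat, hp, hq]
  · simp

theorem Vmat_mulVec_succ (w : Idx N T S A → ℂ) (s : S) (l : Fin N) (r : ∀ i, A i)
    (f : Fin N → Fin (T + 1)) :
    (P.Vmat x).mulVec w (s, l.succ, r, f) = (P.Vm l (x l)).mulVec (fun z =>
      w (z.1, l.succ, Function.update r l z.2, Function.update f l (f l - 1))) (s, r l) := by
  symm
  refine Fintype.sum_of_injective (fun z : S × A l => ((z.1, l.succ, Function.update r l z.2,
    Function.update f l (f l - 1)) : Idx N T S A)) ?_ _ _ ?_ ?_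
  · rintro ⟨a, b⟩ ⟨a', b'⟩ h
    simp only [Prod.mk.injEq] at h
    have := congrFun h.2.2.1 l
    simp at this
    simp [h.1, this]
  · rintro ⟨s', c', r', f'⟩ hq
    have : P.Vmat x (s, l.succ, r, f) (s', c', r', f') = 0 := by
      by_contra hne
      obtain ⟨h1, -, h2⟩ := P.Vmat_ne_zero x hne
      obtain ⟨h3, h4, h5⟩ := h2 l rfl
      simp only at h1 h3 h4 h5
      refine hq ⟨(s', r' l), ?_⟩
      simp only [Prod.mk.injEq, true_and]
      refine ⟨h1.symm, ?_, ?_⟩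
      · funext i
        by_cases hi : i = l
        · subst hi
          simp
        · simp [hi, h3 i hi]
      · funext i
        by_cases hi : i = l
        · subst hi
          simp [← h5]
        · simp [hi, h4 i hi]
    simp [this]
  · intro z
    have hc : (∀ i, i ≠ l → Function.update r l z.2 i = r i) ∧
        (∀ i, i ≠ l → Function.update f l (f l - 1) i = f i) :=
      ⟨fun i hi => Function.update_of_ne hi _ _, fun i hi => Function.update_of_ne hi _ _⟩
    have : P.Vmat x (s, l.succ, r, f) (z.1, l.succ, Function.update r l z.2,
        Function.update f l (f l - 1)) = P.Vm l (x l) (s, r l) z := by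
      rw [Vmat_apply_succ, if_pos ⟨rfl, hc.1, hc.2, by simp⟩]
      exact congrArg (P.Vm l (x l) (s, r l)) (Prod.ext rfl (Function.update_self ..))
    exact congrArg (· * _) this.symm

end Protocol

theorem sum_split_lab (l : Fin N) (u : S → (∀ i, A i) → (Fin N → Fin (T + 1)) → ℝ) :
    ∑ s, ∑ r, ∑ f, u s r f = ∑ f, ∑ r' : ((j : {j // j ≠ l}) → A j), ∑ z : S × A l,
      u z.1 ((Equiv.piSplitAt l A).symm (z.2, r')) f := by
  have h1 : ∀ s, ∑ r, ∑ f, u s r f =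
      ∑ f, ∑ r', ∑ b, u s ((Equiv.piSplitAt l A).symm (b, r')) f := by
    intro s
    rw [Finset.sum_comm]
    refine Finset.sum_congr rfl fun f _ => ?_
    rw [← Equiv.sum_comp (Equiv.piSplitAt l A).symm, Fintype.sum_prod_type, Finset.sum_comm]
  simp only [h1]
  rw [Finset.sum_comm]
  refine Finset.sum_congr rfl fun f _ => ?_
  rw [Finset.sum_comm]
  refine Finset.sum_congr rfl fun r' _ => ?_
  rw [Fintype.sum_prod_type]

theorem piSplitAt_symm_apply_self (l : Fin N) (b : A l) (r' : (j : {j // j ≠ l}) → A j) :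
    (Equiv.piSplitAt l A).symm (b, r') l = b := by
  simp [Equiv.piSplitAt]

theorem update_piSplitAt_symm (l : Fin N) (b b' : A l) (r' : (j : {j // j ≠ l}) → A j) :
    Function.update ((Equiv.piSplitAt l A).symm (b, r')) l b' =
      (Equiv.piSplitAt l A).symm (b', r') := by
  funext i
  by_cases hi : i = l
  · subst hi
    simp [Equiv.piSplitAt]
  · simp [Equiv.piSplitAt, hi]

/-- Lowering the flag of lab `l`. -/
def lowerFlag (T : ℕ) (l : Fin N) : (Fin N → Fin (T + 1)) ≃ (Fin N → Fin (T + 1)) where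
  toFun f := Function.update f l (f l - 1)
  invFun f := Function.update f l (f l + 1)
  left_inv f := by simp
  right_inv f := by simp

namespace Protocol

variable (P : Protocol N T S A X) (x : ∀ l, X l)

theorem nsq_Vmat_mulVec (hVm : P.unitaryVm) (w : Idx N T S A → ℂ) :
    nsq ((P.Vmat x).mulVec w) = nsq w := by
  have split : ∀ u : Idx N T S A → ℝ, ∑ p, u p =
      ∑ c, ∑ s, ∑ r, ∑ f, u (s, c, r, f) := by
    intro u
    simp only [Fintype.sum_prod_type]
    rw [Finset.sum_comm]
  unfold nsq
  rw [split, split, Fin.sum_univ_succ, Fin.sum_univ_succ]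
  congr 1
  · refine Finset.sum_congr rfl fun s _ => Finset.sum_congr rfl fun r _ =>
      Finset.sum_congr rfl fun f _ => ?_
    rw [P.Vmat_mulVec_zero x w _ rfl]
  · refine Finset.sum_congr rfl fun l _ => ?_
    rw [sum_split_lab l (fun s r f => Complex.normSq ((P.Vmat x).mulVec w (s, l.succ, r, f))),
      sum_split_lab l (fun s r f => Complex.normSq (w (s, l.succ, r, f)))]
    rw [← Equiv.sum_comp (lowerFlag T l) (fun f => ∑ r' : ((j : {j // j ≠ l}) → A j),
      ∑ z : S × A l, Complex.normSq (w (z.1, l.succ, (Equiv.piSplitAt l A).symm (z.2, r'), f)))]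
    refine Finset.sum_congr rfl fun f _ => Finset.sum_congr rfl fun r' _ => ?_
    simp only [Vmat_mulVec_succ, piSplitAt_symm_apply_self, update_piSplitAt_symm]
    exact sum_normSq_mulVec_of_unitary (hVm l (x l)) (fun z =>
      w (z.1, l.succ, (Equiv.piSplitAt l A).symm (z.2, r'), lowerFlag T l f))

end Protocol

/-- Basis states in which exactly the flags of the labs in `K` are raised, to `1`, and the result
registers of these labs show the outcomes `a`. -/
def sector (a : ∀ i, A i) (K : Finset (Fin N)) : Set (Idx N T S A) :=
  {p | (∀ i, p.2.2.2 i = if i ∈ K then 1 else 0) ∧ ∀ i ∈ K, p.2.2.1 i = a i}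

/-- Basis states with control value `c`. -/
def controlSet (c : Fin (N + 1)) : Set (Idx N T S A) := {p | p.2.1 = c}

theorem sector_congr {a a' : ∀ i, A i} {K : Finset (Fin N)} (h : ∀ i ∈ K, a i = a' i) :
    (sector a K : Set (Idx N T S A)) = sector a' K := by
  ext p
  refine and_congr_right fun _ => forall₂_congr fun i hi => ?_
  rw [h i hi]

theorem mass_eq_control_add (v : Idx N T S A → ℂ) (g : Set (Idx N T S A)) :
    mass v g = mass v (g ∩ controlSet 0) + ∑ l : Fin N, mass v (g ∩ controlSet l.succ) := by
  rw [mass_eq_sum_inter v g (fun p => p.2.1), Fin.sum_univ_succ]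
  rfl

theorem exists_of_mulVec_ne_zero {ι : Type*} [Fintype ι] {M : Matrix ι ι ℂ} {v : ι → ℂ} {p : ι}
    (h : M.mulVec v p ≠ 0) : ∃ q, M p q ≠ 0 ∧ v q ≠ 0 := by
  obtain ⟨q, -, hq⟩ := Finset.exists_ne_zero_of_sum_ne_zero h
  exact ⟨q, left_ne_zero_of_mul hq, right_ne_zero_of_mul hq⟩

namespace Protocol

variable (P : Protocol N T S A X) (x : ∀ l, X l)

theorem Vmat_flag {p q : Idx N T S A} (h : P.Vmat x p q ≠ 0) (i : Fin N) :
    p.2.2.2 i = if q.2.1 = i.succ then q.2.2.2 i + 1 else q.2.2.2 i := by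
  obtain ⟨h1, h2, h3⟩ := P.Vmat_ne_zero x h
  rw [h1]
  rcases Fin.eq_zero_or_eq_succ p.2.1 with hc | ⟨l, hl⟩
  · rw [h2 hc, if_neg]
    rw [hc]
    exact (Fin.succ_ne_zero i).symm
  · obtain ⟨-, h4, h5⟩ := h3 l hl
    by_cases hi : i = l
    · subst hi
      rw [if_pos hl, h5]
    · rw [if_neg, h4 i hi]
      rw [hl, Fin.succ_inj]
      exact Ne.symm hi

theorem Vmat_result {p q : Idx N T S A} (h : P.Vmat x p q ≠ 0) (i : Fin N)
    (hi : q.2.1 ≠ i.succ) : p.2.2.1 i = q.2.2.1 i := by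
  obtain ⟨h1, h2, h3⟩ := P.Vmat_ne_zero x h
  rcases Fin.eq_zero_or_eq_succ p.2.1 with hc | ⟨l, hl⟩
  · rw [h2 hc]
  · refine ((h3 l hl).1 i ?_).symm
    rintro rfl
    exact hi (h1.trans hl)

/-- The state right after the `t`-th lab activation. -/
def after (t : ℕ) : Idx N T S A → ℂ := (P.chain x t).mulVec P.ket0

/-- The state right before the `(t+1)`-th lab activation. -/
def before (t : ℕ) : Idx N T S A → ℂ := (extSC (P.U (t + 1))).mulVec (P.after x t)

theorem after_zero : P.after x 0 = P.ket0 := Matrix.one_mulVec _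

theorem after_succ (t : ℕ) : P.after x (t + 1) = (P.Vmat x).mulVec (P.before x t) := by
  simp [after, before, chain, Matrix.mulVec_mulVec]

theorem ket0_ne_zero {p : Idx N T S A} (h : P.ket0 p ≠ 0) : p = (P.s0, 0, P.r0, fun _ => 0) := by
  by_contra hp
  exact h (if_neg hp)

theorem flag_le_of_before_ne_zero {t : ℕ}
    (H : ∀ p : Idx N T S A, P.after x t p ≠ 0 → ∀ i, (p.2.2.2 i).val ≤ t)
    {p : Idx N T S A} (hp : P.before x t p ≠ 0) (i : Fin N) : (p.2.2.2 i).val ≤ t := by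
  obtain ⟨q, h1, h2⟩ := exists_of_mulVec_ne_zero hp
  rw [extSC_ne_zero h1]
  exact H q h2 i

theorem flag_le_of_after_ne_zero {t : ℕ} :
    ∀ p : Idx N T S A, P.after x t p ≠ 0 → ∀ i, (p.2.2.2 i).val ≤ t := by
  induction t with
  | zero =>
    intro p hp i
    rw [after_zero] at hp
    simp [P.ket0_ne_zero hp]
  | succ t ih =>
    intro p hp i
    rw [after_succ] at hp
    obtain ⟨q, h1, h2⟩ := exists_of_mulVec_ne_zero hp
    have := P.flag_le_of_before_ne_zero x ih h2 i
    rw [P.Vmat_flag x h1 i]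
    split_ifs
    · rw [Fin.val_add_one]
      split_ifs <;> omega
    · omega

theorem flag_le_before {t : ℕ} {p : Idx N T S A} (hp : P.before x t p ≠ 0) (i : Fin N) :
    (p.2.2.2 i).val ≤ t :=
  P.flag_le_of_before_ne_zero x (P.flag_le_of_after_ne_zero x) hp i

theorem mass_before (hU : P.unitaryU) {t : ℕ} (ht : t < T) {g : Set (Idx N T S A)}
    (hg : ∀ p q : Idx N T S A, p.2.2 = q.2.2 → (p ∈ g ↔ q ∈ g)) :
    mass (P.before x t) g = mass (P.after x t) g :=
  mass_mulVec (nsq_extSC_mulVec (hU (t + 1) (by omega) (by omega)))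
    (fun p q h => hg p q (extSC_ne_zero h)) _

theorem mass_after_succ (hVm : P.unitaryVm) (t : ℕ) {g g' : Set (Idx N T S A)}
    (h : ∀ p q, P.Vmat x p q ≠ 0 → (p ∈ g ↔ q ∈ g')) :
    mass (P.after x (t + 1)) g = mass (P.before x t) g' := by
  rw [after_succ]
  exact mass_mulVec (P.nsq_Vmat_mulVec x hVm) h _

theorem mass_overshoot_le_succ (hVm : P.unitaryVm) (hU : P.unitaryU) {t : ℕ} (ht : t < T)
    (i : Fin N) : mass (P.after x t) {p | 2 ≤ (p.2.2.2 i).val} ≤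
      mass (P.after x (t + 1)) {p | 2 ≤ (p.2.2.2 i).val} := by
  rw [P.mass_after_succ x hVm t (g' := {q | 2 ≤ (if q.2.1 = i.succ then q.2.2.2 i + 1 else
      q.2.2.2 i).val}) fun p q h => by
        rw [Set.mem_ofPred_eq, Set.mem_ofPred_eq, P.Vmat_flag x h i],
    ← P.mass_before x hU ht fun p q h => by rw [Set.mem_ofPred_eq, Set.mem_ofPred_eq, h]]
  refine mass_mono fun p hp hne => ?_
  have h1 := P.flag_le_before x hne i
  simp only [Set.mem_ofPred_eq] at hp ⊢
  split_ifs
  · rw [Fin.val_add_one_of_lt (Fin.lt_def.2 (by simp; omega))]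
    omega
  · exact hp

theorem flag_le_one_of_after_ne_zero (hVm : P.unitaryVm) (hU : P.unitaryU) (hflag : P.flagOK x)
    {t : ℕ} (ht : t ≤ T) {p : Idx N T S A} (hp : P.after x t p ≠ 0) (i : Fin N) :
    (p.2.2.2 i).val ≤ 1 := by
  have mono : ∀ n, t ≤ n → n ≤ T → mass (P.after x t) {p | 2 ≤ (p.2.2.2 i).val} ≤
      mass (P.after x n) {p | 2 ≤ (p.2.2.2 i).val} := by
    intro n hn
    induction n, hn using Nat.le_induction with
    | base => exact fun _ => le_rfl
    | succ n hn ih =>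
      exact fun h => (ih (by omega)).trans (P.mass_overshoot_le_succ x hVm hU (by omega) i)
  have hT : mass (P.after x T) {p | 2 ≤ (p.2.2.2 i).val} = 0 := by
    rw [mass_eq_zero_iff]
    intro q hq
    by_contra hne
    rw [Set.mem_ofPred_eq, hflag q hne i] at hq
    have : ((1 : Fin (T + 1)) : ℕ) ≤ 1 := Nat.mod_le 1 (T + 1)
    omega
  have h0 := le_antisymm ((mono T ht le_rfl).trans hT.le) (mass_nonneg _ _)
  rw [mass_eq_zero_iff] at h0
  by_contra hlt
  exact hp (h0 p (by simp only [Set.mem_ofPred_eq]; omega))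

end Protocol

namespace Protocol

variable (P : Protocol N T S A X) (x x' : ∀ l, X l) (a a' : ∀ i, A i) (K : Finset (Fin N))
  (l : Fin N)

/-- Total mass entering the sector of `K` through an activation of lab `l`. -/
def inflow : ℝ :=
  ∑ t ∈ Finset.range T, mass (P.after x (t + 1)) (sector a K ∩ controlSet l.succ)

/-- Total mass leaving the sector of `K` through an activation of lab `l`. -/
def outflow : ℝ :=
  ∑ t ∈ Finset.range T, mass (P.before x t) (sector a K ∩ controlSet l.succ)

theorem inflow_nonneg : 0 ≤ P.inflow x a K l :=
  Finset.sum_nonneg fun _ _ => mass_nonneg _ _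

theorem outflow_nonneg : 0 ≤ P.outflow x a K l :=
  Finset.sum_nonneg fun _ _ => mass_nonneg _ _

/-! ### Dependence on the settings -/

variable {x x' a a' K l}

theorem before_eq_of_after_eq {t : ℕ}
    (H : ∀ p : Idx N T S A, (∀ i ∉ K, p.2.2.2 i = 0) → P.after x t p = P.after x' t p)
    {p : Idx N T S A} (hp : ∀ i ∉ K, p.2.2.2 i = 0) : P.before x t p = P.before x' t p := by
  refine Finset.sum_congr rfl fun q _ => ?_
  by_cases hq : extSC (P.U (t + 1)) p q = 0
  · simp only [hq, zero_mul]
  · rw [H q (by rwa [extSC_ne_zero hq] at hp)]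

theorem after_eq_of_settings_eq (hx : ∀ i ∈ K, x i = x' i) {t : ℕ} (ht : t ≤ T) :
    ∀ p : Idx N T S A, (∀ i ∉ K, p.2.2.2 i = 0) → P.after x t p = P.after x' t p := by
  induction t with
  | zero => simp [after_zero]
  | succ t ih =>
    rintro ⟨s, c, r, f⟩ hp
    have hb : ∀ q : Idx N T S A, (∀ i ∉ K, q.2.2.2 i = 0) → P.before x t q = P.before x' t q :=
      fun q => P.before_eq_of_after_eq (ih (by omega))
    rw [after_succ, after_succ]
    rcases Fin.eq_zero_or_eq_succ c with rfl | ⟨l, rfl⟩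
    · rw [P.Vmat_mulVec_zero x _ _ rfl, P.Vmat_mulVec_zero x' _ _ rfl]
      exact hb _ hp
    · rw [Vmat_mulVec_succ, Vmat_mulVec_succ]
      by_cases hl : l ∈ K
      · rw [hx l hl]
        refine congrFun (congrArg _ (funext fun z => hb _ fun i hi => ?_)) _
        have : i ≠ l := fun h => hi (h ▸ hl)
        exact (Function.update_of_ne this _ _).trans (hp i hi)
      · have hz : ∀ (y : ∀ l, X l) (z : S × A l), P.before y t (z.1, l.succ,
            Function.update r l z.2, Function.update f l (f l - 1)) = 0 := by
          intro y z
          by_contra hne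
          have h1 := P.flag_le_before y hne l
          have h2 : f l = 0 := hp l hl
          simp [h2] at h1
          omega
        simp only [hz]
        simp only [Matrix.mulVec, dotProduct, mul_zero]

theorem inflow_congr (hx : ∀ i ∈ K, x i = x' i) (ha : ∀ i ∈ K, a i = a' i) :
    P.inflow x a K l = P.inflow x' a' K l := by
  unfold inflow
  rw [sector_congr ha]
  refine Finset.sum_congr rfl fun t ht => mass_congr fun p hp => ?_
  refine P.after_eq_of_settings_eq hx (Finset.mem_range.1 ht) p fun i hi => ?_
  rw [hp.1.1 i, if_neg hi]

theorem outflow_congr (hx : ∀ i ∈ K, x i = x' i) (ha : ∀ i ∈ K, a i = a' i) :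
    P.outflow x a K l = P.outflow x' a' K l := by
  unfold outflow
  rw [sector_congr ha]
  refine Finset.sum_congr rfl fun t ht => mass_congr fun p hp => ?_
  refine P.before_eq_of_after_eq
    (P.after_eq_of_settings_eq hx (Finset.mem_range.1 ht).le) fun i hi => ?_
  rw [hp.1.1 i, if_neg hi]

/-! ### Conservation of mass -/

theorem inflow_eq_zero (hl : l ∉ K) : P.inflow x a K l = 0 := by
  refine Finset.sum_eq_zero fun t ht => ?_
  rw [mass_eq_zero_iff]
  rintro p ⟨⟨hp, -⟩, hc⟩
  by_contra hne
  rw [after_succ] at hne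
  obtain ⟨q, h1, h2⟩ := exists_of_mulVec_ne_zero hne
  have h3 := P.Vmat_flag x h1 l
  have h4 := P.flag_le_before x h2 l
  have hc' : q.2.1 = l.succ := (P.Vmat_ne_zero x h1).1.trans hc
  rw [hp l, if_neg hl, if_pos hc'] at h3
  rw [eq_neg_of_add_eq_zero_left h3.symm] at h4
  have := Finset.mem_range.1 ht
  simp at h4
  omega

theorem outflow_eq_zero (hVm : P.unitaryVm) (hU : P.unitaryU) (hflag : P.flagOK x) (hl : l ∈ K) :
    P.outflow x a K l = 0 := by
  refine Finset.sum_eq_zero fun t ht => ?_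
  have ht := Finset.mem_range.1 ht
  by_cases hT : T = 1
  · rw [mass_eq_zero_iff]
    rintro p ⟨⟨hp, -⟩, hc⟩
    by_contra hne
    have h1 := P.flag_le_before x hne l
    rw [hp l, if_pos hl] at h1
    subst hT
    simp at h1
    omega
  have h1v : ((1 : Fin (T + 1)) : ℕ) = 1 := by
    change 1 % (T + 1) = 1
    exact Nat.mod_eq_of_lt (by omega)
  have h2v : ((1 + 1 : Fin (T + 1)) : ℕ) = 2 := by
    rw [Fin.val_add_one_of_lt (Fin.lt_def.2 (by rw [h1v, Fin.val_last]; omega)), h1v]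
  refine le_antisymm ?_ (mass_nonneg _ _)
  calc mass (P.before x t) (sector a K ∩ controlSet l.succ)
      ≤ mass (P.before x t) {q | q.2.1 = l.succ ∧ q.2.2.2 l = 1} := by
        refine mass_mono fun p hp _ => ⟨hp.2, ?_⟩
        rw [hp.1.1 l, if_pos hl]
    _ = mass (P.after x (t + 1)) {q | q.2.1 = l.succ ∧ q.2.2.2 l = 1 + 1} := by
        refine (P.mass_after_succ x hVm t fun p q h => ?_).symm
        rw [Set.mem_ofPred_eq, Set.mem_ofPred_eq, (P.Vmat_ne_zero x h).1]
        refine and_congr_right fun hc => ?_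
        rw [P.Vmat_flag x h l, (P.Vmat_ne_zero x h).1, if_pos hc, add_left_inj]
    _ = 0 := by
        rw [mass_eq_zero_iff]
        rintro p ⟨-, hp⟩
        by_contra hne
        have := P.flag_le_one_of_after_ne_zero x hVm hU hflag (by omega) hne l
        rw [hp, h2v] at this
        omega

theorem mass_sector_inter_control_zero (hVm : P.unitaryVm) (t : ℕ) :
    mass (P.after x (t + 1)) (sector a K ∩ controlSet 0) =
      mass (P.before x t) (sector a K ∩ controlSet 0) := by
  refine P.mass_after_succ x hVm t fun p q h => ?_
  obtain ⟨h1, h2, -⟩ := P.Vmat_ne_zero x h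
  constructor
  · intro hp
    rwa [h2 hp.2]
  · intro hq
    rwa [h2 (h1.symm.trans hq.2)] at hq

theorem sum_inflow_sub_sum_outflow (hVm : P.unitaryVm) (hU : P.unitaryU) :
    ∑ l, P.inflow x a K l - ∑ l, P.outflow x a K l =
      mass (P.after x T) (sector a K) - mass (P.after x 0) (sector a K) := by
  rw [← Finset.sum_range_sub (fun t => mass (P.after x t) (sector a K))]
  unfold inflow outflow
  rw [Finset.sum_comm, Finset.sum_comm (s := Finset.univ), ← Finset.sum_sub_distrib]
  refine Finset.sum_congr rfl fun t ht => ?_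
  rw [← P.mass_before x hU (Finset.mem_range.1 ht) (g := sector a K)
      fun p q h => by simp only [sector, Set.mem_ofPred_eq, h],
    mass_eq_control_add (P.after x (t + 1)), mass_eq_control_add (P.before x t),
    P.mass_sector_inter_control_zero hVm]
  ring

theorem sum_inflow_update (hVm : P.unitaryVm) (hl : l ∉ K) :
    ∑ b, P.inflow x (Function.update a l b) (insert l K) l = P.outflow x a K l := by
  unfold inflow outflow
  rw [Finset.sum_comm]
  refine Finset.sum_congr rfl fun t _ => ?_
  rw [← P.mass_after_succ x hVm t (g := {p | (∀ i, p.2.2.2 i = if i ∈ insert l K then 1 else 0) ∧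
    ∀ i ∈ K, p.2.2.1 i = a i} ∩ controlSet l.succ),
    mass_eq_sum_inter _ _ (fun p => p.2.2.1 l)]
  · refine Finset.sum_congr rfl fun b _ => congrArg _ ?_
    ext p
    have hne : ∀ i ∈ K, i ≠ l := fun i hi h => hl (h ▸ hi)
    simp only [sector, controlSet, Set.mem_inter_iff, Set.mem_ofPred_eq,
      Finset.forall_mem_insert, Function.update_self]
    have : (∀ i ∈ K, p.2.2.1 i = Function.update a l b i) ↔ ∀ i ∈ K, p.2.2.1 i = a i :=
      forall₂_congr fun i hi => by rw [Function.update_of_ne (hne i hi)]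
    rw [this]
    tauto
  · intro p q h
    have h1 := (P.Vmat_ne_zero x h).1
    simp only [sector, controlSet, Set.mem_inter_iff, Set.mem_ofPred_eq, h1]
    refine and_congr_left fun hc => and_congr (forall_congr' fun i => ?_)
      (forall₂_congr fun i hi => ?_)
    · simp only [P.Vmat_flag x h i, h1, hc, Fin.succ_inj]
      by_cases hi : i = l
      · subst hi
        simp [hl]
      · simp [hi, Ne.symm hi]
    · rw [P.Vmat_result x h i]
      rw [h1, hc, Ne, Fin.succ_inj]
      rintro rfl
      exact hl hi

theorem inflow_insert_le_outflow (hVm : P.unitaryVm) (hl : l ∉ K) :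
    P.inflow x a (insert l K) l ≤ P.outflow x a K l := by
  rw [← P.sum_inflow_update hVm hl]
  refine le_of_eq_of_le ?_ (Finset.single_le_sum
    (f := fun b => P.inflow x (Function.update a l b) (insert l K) l)
    (fun _ _ => P.inflow_nonneg ..) (Finset.mem_univ (a l)))
  simp

theorem mass_initial_sector (hT : T ≠ 0) :
    mass (P.after x 0) (sector a K) = if K = ∅ then 1 else 0 := by
  classical
  rw [after_zero]
  split_ifs with hK
  · subst hK
    unfold mass nsq
    rw [Finset.sum_eq_single (P.s0, 0, P.r0, fun _ => 0)]
    · simp [sector, ket0]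
    · intro p _ hp
      simp [Set.indicator_apply, ket0, hp]
    · simp
  · rw [mass_eq_zero_iff]
    intro p hp
    by_contra hne
    obtain ⟨i, hi⟩ := Finset.nonempty_iff_ne_empty.2 hK
    have := hp.1 i
    rw [P.ket0_ne_zero hne, if_pos hi] at this
    exact hT (by simpa using this.symm)

theorem mass_final_sector_of_ne_univ (hT : T ≠ 0) (hflag : P.flagOK x) (hK : K ≠ Finset.univ) :
    mass (P.after x T) (sector a K) = 0 := by
  rw [mass_eq_zero_iff]
  intro p hp
  by_contra hne
  obtain ⟨i, hi⟩ : ∃ i, i ∉ K := by simpa [Finset.eq_univ_iff_forall] using hK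
  have := hflag p hne i
  rw [hp.1 i, if_neg hi] at this
  exact hT (by simpa using this)

theorem mass_final_sector_univ (hflag : P.flagOK x) :
    mass (P.after x T) (sector a Finset.univ) = P.pQ x a := by
  classical
  refine congrArg nsq (funext fun p => ?_)
  change _ = if p.2.2.1 = a then P.after x T p else 0
  by_cases hne : P.after x T p = 0
  · simp [Set.indicator_apply, hne]
  · have h := hflag p hne
    rw [Set.indicator_apply]
    refine if_congr ?_ rfl rfl
    simp [sector, h, funext_iff]

end Protocol

/-! ### Sums over orderings -/

theorem sum_powersetCard_compl_insert {α M : Type*} [Fintype α] [DecidableEq α] [AddCommMonoid M]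
    (F : Finset α → α → M) (n : ℕ) :
    ∑ K ∈ Finset.powersetCard n Finset.univ, ∑ l ∈ Kᶜ, F (insert l K) l =
      ∑ K ∈ Finset.powersetCard (n + 1) Finset.univ, ∑ l ∈ K, F K l := by
  rw [Finset.sum_sigma', Finset.sum_sigma']
  refine Finset.sum_bij' (fun z _ => ⟨insert z.2 z.1, z.2⟩) (fun z _ => ⟨z.1.erase z.2, z.2⟩)
    ?_ ?_ ?_ ?_ ?_
  · rintro ⟨K, l⟩ h
    simp only [Finset.mem_sigma, Finset.mem_powersetCard_univ, Finset.mem_compl] at h ⊢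
    simp [h.1, Finset.card_insert_of_notMem h.2]
  · rintro ⟨K, l⟩ h
    simp only [Finset.mem_sigma, Finset.mem_powersetCard_univ, Finset.mem_compl] at h ⊢
    simp [h.1, Finset.card_erase_of_mem h.2]
  · rintro ⟨K, l⟩ h
    simp only [Finset.mem_sigma, Finset.mem_compl] at h
    simp [Finset.erase_insert h.2]
  · rintro ⟨K, l⟩ h
    simp only [Finset.mem_sigma] at h
    simp [Finset.insert_erase h.2]
  · intros
    rfl

/-- The sum over all ways to add `k` further labs to `K`, one at a time, of the product of the
transition weights `c`. -/
def pathSum (c : Finset (Fin N) → Fin N → ℝ) : ℕ → Finset (Fin N) → ℝ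
  | 0, _ => 1
  | k + 1, K => ∑ l ∈ Kᶜ, c K l * pathSum c k (insert l K)

theorem mul_pathSum_of_conserved {c e : Finset (Fin N) → Fin N → ℝ} {w : Finset (Fin N) → ℝ}
    (hout : ∀ K, ∀ l ∉ K, w K * c K l = e (insert l K) l)
    (hin : ∀ K, K ≠ ∅ → ∑ l ∈ K, e K l = w K) :
    w ∅ * pathSum c N ∅ = w Finset.univ := by
  have key : ∀ k n, n + k = N →
      ∑ K ∈ Finset.powersetCard n Finset.univ, w K * pathSum c k K = w Finset.univ := by
    intro k
    induction k with
    | zero =>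
      rintro n hn
      have : Finset.powersetCard n (Finset.univ : Finset (Fin N)) = {Finset.univ} := by
        rw [show n = (Finset.univ : Finset (Fin N)).card by simpa using hn,
          Finset.powersetCard_self]
      simp [this, pathSum]
    | succ k ih =>
      intro n hn
      rw [← ih (n + 1) (by omega)]
      trans ∑ K ∈ Finset.powersetCard n Finset.univ, ∑ l ∈ Kᶜ,
        e (insert l K) l * pathSum c k (insert l K)
      · refine Finset.sum_congr rfl fun K _ => ?_
        rw [pathSum, Finset.mul_sum]
        refine Finset.sum_congr rfl fun l hl => ?_
        rw [← mul_assoc, hout K l (Finset.mem_compl.1 hl)]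
      · rw [sum_powersetCard_compl_insert (fun K l => e K l * pathSum c k K)]
        refine Finset.sum_congr rfl fun K hK => ?_
        rw [← Finset.sum_mul, hin]
        rintro rfl
        simp at hK
  simpa using key N 0 (zero_add N)

/-! ### Histories -/

/-- The labs occurring in a history. -/
def labs (H : Hist N A X) : Finset (Fin N) := (H.map Sigma.fst).toFinset

theorem notMem_labs {H : Hist N A X} {l : Fin N} : l ∉ labs H ↔ ∀ e ∈ H, e.1 ≠ l := by
  simp only [labs, List.mem_toFinset, List.mem_map, not_exists, not_and, ne_eq]

theorem filter_notMem_labs (H : Hist N A X)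
    [DecidablePred fun l : Fin N => ∀ e ∈ H, e.1 ≠ l] :
    Finset.univ.filter (fun l : Fin N => ∀ e ∈ H, e.1 ≠ l) = (labs H)ᶜ := by
  ext l
  rw [Finset.mem_compl, notMem_labs]
  simp

theorem labs_append_singleton (H : Hist N A X) (l : Fin N) (v : A l × X l) :
    labs (H ++ [⟨l, v⟩]) = insert l (labs H) := by
  ext i
  simp [labs, eq_comm]

theorem labs_ne_univ {H : Hist N A X} (h : H.length < N) : labs H ≠ Finset.univ := by
  intro hu
  have := (List.toFinset_card_le (H.map Sigma.fst)).trans_eq (List.length_map _)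
  rw [show (H.map Sigma.fst).toFinset = Finset.univ from hu] at this
  simp at this
  omega

open Classical in
/-- The outcomes and settings recorded in a history, completed by the default values `d`. -/
def recorded (d : ∀ l, A l × X l) (H : Hist N A X) (l : Fin N) : A l × X l :=
  if h : ∃ v : A l × X l, ⟨l, v⟩ ∈ H then h.choose else d l

theorem recorded_eq {d v : ∀ l, A l × X l} {H : Hist N A X} (hH : ∀ e ∈ H, e.2 = v e.1)
    {l : Fin N} (hl : l ∈ labs H) : recorded d H l = v l := by
  have h : ∃ v : A l × X l, ⟨l, v⟩ ∈ H := by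
    simp only [labs, List.mem_toFinset, List.mem_map] at hl
    obtain ⟨⟨_, v⟩, hv, rfl⟩ := hl
    exact ⟨v, hv⟩
  rw [recorded, dif_pos h]
  exact hH _ h.choose_spec

theorem causalSum_eq_pathSum [∀ i, Fintype (X i)] [∀ i, DecidableEq (X i)]
    {q : Hist N A X → Fin N → ℝ}
    {o : Hist N A X → (l : Fin N) → X l → A l → ℝ} {x : ∀ i, X i} {a : ∀ i, A i}
    {c : Finset (Fin N) → Fin N → ℝ}
    (h : ∀ H : Hist N A X, (∀ e ∈ H, e.2 = (a e.1, x e.1)) → ∀ l ∉ labs H,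
      q H l * o H l (x l) (a l) = c (labs H) l) (k : ℕ) :
    ∀ H : Hist N A X, (∀ e ∈ H, e.2 = (a e.1, x e.1)) →
      causalSum q o x a k H = pathSum c k (labs H) := by
  induction k with
  | zero => exact fun _ _ => rfl
  | succ k ih =>
    intro H hH
    rw [causalSum, pathSum, ← Finset.sum_filter, filter_notMem_labs]
    refine Finset.sum_congr rfl fun l hl => ?_
    rw [h H hH l (Finset.mem_compl.1 hl), ih, labs_append_singleton]
    intro e he
    rcases List.mem_append.1 he with he | he
    · exact hH e he
    · rw [List.mem_singleton.1 he]

theorem sum_div_total_or_uniform {α : Type*} {s : Finset α} (hs : s.Nonempty) (f : α → ℝ) :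
    ∑ l ∈ s, (if ∑ m ∈ s, f m = 0 then (s.card : ℝ)⁻¹ else f l / ∑ m ∈ s, f m) = 1 := by
  have : (s.card : ℝ) ≠ 0 := by exact_mod_cast hs.card_pos.ne'
  split_ifs with h
  · simp [this]
  · rw [← Finset.sum_div, div_self h]

/-! ### The causal model of a protocol -/

namespace Protocol

variable (P : Protocol N T S A X) (x x' : ∀ l, X l) (a a' : ∀ i, A i) (K : Finset (Fin N))
  (l : Fin N)

/-- The probability that lab `l` acts next when the labs in `K` have acted. -/
def nextProb : ℝ :=
  if ∑ m ∈ Kᶜ, P.outflow x a K m = 0 then ((Kᶜ).card : ℝ)⁻¹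
  else P.outflow x a K l / ∑ m ∈ Kᶜ, P.outflow x a K m

/-- The probability that lab `l`, acting after the labs in `K`, obtains the outcome `a l`. -/
def outcomeProb : ℝ :=
  if l ∈ K ∨ P.outflow x a K l = 0 then (if a l = P.r0 l then 1 else 0)
  else P.inflow x a (insert l K) l / P.outflow x a K l

theorem nextProb_nonneg : 0 ≤ P.nextProb x a K l := by
  unfold nextProb
  split_ifs
  · positivity
  · exact div_nonneg (P.outflow_nonneg ..) (Finset.sum_nonneg fun _ _ => P.outflow_nonneg ..)

theorem outcomeProb_nonneg : 0 ≤ P.outcomeProb x a K l := by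
  unfold outcomeProb
  split_ifs
  · exact zero_le_one
  · exact le_rfl
  · exact div_nonneg (P.inflow_nonneg ..) (P.outflow_nonneg ..)

variable {x x' a a' K l}

theorem sum_nextProb (hK : K ≠ Finset.univ) : ∑ l ∈ Kᶜ, P.nextProb x a K l = 1 :=
  sum_div_total_or_uniform (Finset.nonempty_iff_ne_empty.2 (by simpa using hK)) _

theorem sum_outcomeProb (hVm : P.unitaryVm) :
    ∑ b, P.outcomeProb x (Function.update a l b) K l = 1 := by
  unfold outcomeProb
  by_cases hl : l ∈ K
  · simp [hl]
  have hout : ∀ b, P.outflow x (Function.update a l b) K l = P.outflow x a K l := fun b =>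
    P.outflow_congr (fun _ _ => rfl) fun i hi =>
      Function.update_of_ne (ne_of_mem_of_not_mem hi hl) _ _
  simp only [hout, hl, false_or]
  split_ifs with h
  · simp
  · rw [← Finset.sum_div, P.sum_inflow_update hVm hl, div_self h]

theorem nextProb_congr (hx : ∀ i ∈ K, x i = x' i) (ha : ∀ i ∈ K, a i = a' i) :
    P.nextProb x a K l = P.nextProb x' a' K l := by
  have h : ∀ m, P.outflow x a K m = P.outflow x' a' K m := fun m => P.outflow_congr hx ha
  simp only [nextProb, h]

theorem outcomeProb_congr (hx : ∀ i ∈ insert l K, x i = x' i)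
    (ha : ∀ i ∈ insert l K, a i = a' i) :
    P.outcomeProb x a K l = P.outcomeProb x' a' K l := by
  have h : P.outflow x a K l = P.outflow x' a' K l :=
    P.outflow_congr (fun i hi => hx i (Finset.mem_insert_of_mem hi))
      fun i hi => ha i (Finset.mem_insert_of_mem hi)
  rw [outcomeProb, outcomeProb, h, P.inflow_congr hx ha, ha l (Finset.mem_insert_self _ _)]

theorem total_mul_nextProb_mul_outcomeProb (hVm : P.unitaryVm) (hl : l ∉ K) :
    (∑ m ∈ Kᶜ, P.outflow x a K m) * (P.nextProb x a K l * P.outcomeProb x a K l) =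
      P.inflow x a (insert l K) l := by
  have h1 := P.inflow_insert_le_outflow (x := x) (a := a) hVm hl
  have h2 : P.outflow x a K l ≤ ∑ m ∈ Kᶜ, P.outflow x a K m :=
    Finset.single_le_sum (f := fun m => P.outflow x a K m) (fun _ _ => P.outflow_nonneg ..) (Finset.mem_compl.2 hl)
  have h0 := P.inflow_nonneg x a (insert l K) l
  unfold nextProb outcomeProb
  by_cases hD : ∑ m ∈ Kᶜ, P.outflow x a K m = 0
  · rw [hD, zero_mul]
    linarith
  · rw [if_neg hD, ← mul_assoc, mul_div_cancel₀ _ hD]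
    by_cases ho : P.outflow x a K l = 0
    · rw [ho, zero_mul]
      linarith
    · rw [if_neg (by simp [hl, ho]), mul_div_cancel₀ _ ho]

theorem pQ_eq_pathSum (hT : T ≠ 0) (hVm : P.unitaryVm) (hU : P.unitaryU)
    (hflag : P.flagOK x) : P.pQ x a =
      pathSum (fun K l => P.nextProb x a K l * P.outcomeProb x a K l) N ∅ := by
  have hsum : ∀ K, ∑ l ∈ K, P.inflow x a K l + (if K = ∅ then 1 else 0) =
      ∑ l ∈ Kᶜ, P.outflow x a K l + mass (P.after x T) (sector a K) := by
    intro K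
    have h := P.sum_inflow_sub_sum_outflow (x := x) (a := a) (K := K) hVm hU
    rw [P.mass_initial_sector hT, ← Finset.sum_add_sum_compl K, ← Finset.sum_add_sum_compl K,
      Finset.sum_eq_zero (s := Kᶜ) fun l hl => P.inflow_eq_zero (Finset.mem_compl.1 hl),
      Finset.sum_eq_zero (s := K) fun l hl => P.outflow_eq_zero hVm hU hflag hl] at h
    linarith
  have key := mul_pathSum_of_conserved
    (c := fun K l => P.nextProb x a K l * P.outcomeProb x a K l)
    (e := fun K l => P.inflow x a K l)
    (w := fun K => ∑ l ∈ Kᶜ, P.outflow x a K l + mass (P.after x T) (sector a K)) ?_ ?_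
  · rw [← hsum ∅] at key
    simpa [P.mass_final_sector_univ hflag] using key.symm
  · intro K l hl
    have hK : K ≠ Finset.univ := by
      rintro rfl
      exact hl (Finset.mem_univ l)
    rw [P.mass_final_sector_of_ne_univ hT hflag hK, add_zero,
      P.total_mul_nextProb_mul_outcomeProb hVm hl]
  · intro K hK
    rw [← hsum K, if_neg hK, add_zero]

end Protocol

end CIQ

end


/-- **Theorem 1** (Purves–Short): every quantum protocol (any `N ≥ 1` parties,
`T ≥ N` time steps, any finite-dimensional system, any measurement unitaries and
inter-step unitaries, satisfying the flag constraint for every choice of settings)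
produces an outcome distribution that is causal: there are 'who is next?' probabilities
`q` and 'what did they see?' probabilities `o` as in Definition 1 reproducing
`p^quantum(a⃗|x⃗)` for all settings and outcomes.  Hence quantum theory cannot violate
a causal inequality. -/
theorem quantum_cannot_violate_causal_inequality
    (N T : ℕ) (S : Type) [Fintype S] [DecidableEq S]
    (A : Fin N → Type) [∀ i, Fintype (A i)] [∀ i, DecidableEq (A i)]
    (X : Fin N → Type) [∀ i, Fintype (X i)] [∀ i, DecidableEq (X i)]
    (hN : 1 ≤ N) (hT : N ≤ T)
    (P : Protocol N T S A X) (hVm : P.unitaryVm) (hU : P.unitaryU)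
    (hflag : ∀ x : ∀ l, X l, P.flagOK x) :
    ∃ (q : Hist N A X → Fin N → ℝ) (o : Hist N A X → (l : Fin N) → X l → A l → ℝ),
      (∀ (H : Hist N A X) (l : Fin N), 0 ≤ q H l) ∧
      (∀ (H : Hist N A X) (l : Fin N) (xv : X l) (a : A l), 0 ≤ o H l xv a) ∧
      (∀ H : Hist N A X, labsDistinct H → H.length < N →
        ∑ l ∈ Finset.univ.filter (fun l : Fin N => ∀ e ∈ H, e.1 ≠ l), q H l = 1) ∧
      (∀ (H : Hist N A X) (l : Fin N) (xv : X l), ∑ a : A l, o H l xv a = 1) ∧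
      (∀ (x : ∀ l, X l) (a : ∀ i, A i), P.pQ x a = causalSum q o x a N []) := by
  have hT0 : T ≠ 0 := by omega
  by_cases hX : Nonempty (∀ l, X l)
  · obtain ⟨x₀⟩ := hX
    let rx (H : Hist N A X) (l : Fin N) : X l := (recorded (fun l => (P.r0 l, x₀ l)) H l).2
    let ra (H : Hist N A X) (l : Fin N) : A l := (recorded (fun l => (P.r0 l, x₀ l)) H l).1
    refine ⟨fun H l => P.nextProb (rx H) (ra H) (labs H) l,
      fun H l xv b => P.outcomeProb (Function.update (rx H) l xv) (Function.update (ra H) l b)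
        (labs H) l,
      fun H l => P.nextProb_nonneg .., fun H l xv b => P.outcomeProb_nonneg .., ?_,
      fun H l xv => P.sum_outcomeProb hVm, fun x a => ?_⟩
    · intro H _ hlen
      rw [filter_notMem_labs]
      exact P.sum_nextProb (labs_ne_univ hlen)
    · rw [P.pQ_eq_pathSum hT0 hVm hU (hflag x)]
      refine (causalSum_eq_pathSum ?_ N [] (by simp)).symm
      intro H hH l hl
      have hrec : ∀ i ∈ labs H, recorded (fun l => (P.r0 l, x₀ l)) H i = (a i, x i) :=
        fun i hi => recorded_eq (v := fun i => (a i, x i)) hH hi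
      have hx : ∀ i ∈ labs H, rx H i = x i := fun i hi => congrArg Prod.snd (hrec i hi)
      have ha : ∀ i ∈ labs H, ra H i = a i := fun i hi => congrArg Prod.fst (hrec i hi)
      have hne : ∀ i ∈ labs H, i ≠ l := fun i hi h => hl (h ▸ hi)
      rw [P.nextProb_congr hx ha]
      congr 1
      refine P.outcomeProb_congr ?_ ?_ <;> rw [Finset.forall_mem_insert]
      · refine ⟨Function.update_self .., fun i hi => ?_⟩
        rw [Function.update_of_ne (hne i hi), hx i hi]
      · refine ⟨Function.update_self .., fun i hi => ?_⟩
        rw [Function.update_of_ne (hne i hi), ha i hi]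
  · refine ⟨fun H _ => (((labs H)ᶜ).card : ℝ)⁻¹, fun _ l _ b => if b = P.r0 l then 1 else 0,
      fun H l => by positivity, fun H l xv b => by positivity, ?_, fun H l xv => by simp,
      fun x => absurd ⟨x⟩ hX⟩
    intro H _ hlen
    rw [filter_notMem_labs]
    have := sum_div_total_or_uniform (s := (labs H)ᶜ)
      (Finset.nonempty_iff_ne_empty.2 (by simpa using labs_ne_univ hlen)) (fun _ => 0)
    simpa using this
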